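/- arXiv:2307.13535 — 4 statements merged into one kernel-verified Lean document; each statement's English description precedes it below -/
import Mathlib

section
/- Let v* ∈ ℝ^d be a unit vector with v* ∈ 𝓜, let λ > 0, Σ := λ v* v*ᵀ + I_d, let Σ̂ be any symmetric d×d matrix, and W := Σ̂ − Σ. Let v̂ be a maximizer of v ↦ vᵀ Σ̂ v over 𝓜 ∩ S^{d−1} satisfying ⟨v*, v̂⟩ ≥ 0. Let L̂ ∈ {L_1, …, L_M} be a subspace containing v̂, let L* ∈ {L_1, …, L_M} be a subspace containing v*, and set F̂ := span(L̂ ∪ L*). Then ‖v̂ − v*‖₂ ≤ (2√2 / λ) · ρ(W, F̂). -/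
open MeasureTheory ProbabilityTheory Matrix Finset

noncomputable section

namespace StructuredPCA

/-- Euclidean inner product on `Fin d → ℝ`. -/
def ip {d : ℕ} (u v : Fin d → ℝ) : ℝ := ∑ i, u i * v i

/-- Euclidean norm on `Fin d → ℝ`. -/
def nrm {d : ℕ} (v : Fin d → ℝ) : ℝ := Real.sqrt (∑ i, v i ^ 2)

/-- Quadratic form `vᵀ A v`. -/
def quad {d : ℕ} (A : Matrix (Fin d) (Fin d) ℝ) (v : Fin d → ℝ) : ℝ := ip v (A.mulVec v)

/-- `ρ(A, S) = sup { |vᵀ A v| : v ∈ S, ‖v‖ = 1 }`. -/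
def rho {d : ℕ} (A : Matrix (Fin d) (Fin d) ℝ) (S : Set (Fin d → ℝ)) : ℝ :=
  sSup {x : ℝ | ∃ v ∈ S, nrm v = 1 ∧ x = |quad A v|}

/-- Frobenius norm of a matrix. -/
def frob {d : ℕ} (A : Matrix (Fin d) (Fin d) ℝ) : ℝ :=
  Real.sqrt (∑ i, ∑ j, A i j ^ 2)

/-- Operator (spectral) norm of a matrix. -/
def opNorm {d : ℕ} (A : Matrix (Fin d) (Fin d) ℝ) : ℝ :=
  sSup {x : ℝ | ∃ v, nrm v = 1 ∧ x = nrm (A.mulVec v)}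

/-- The spiked covariance `λ v* v*ᵀ + I`. -/
def spikedCov {d : ℕ} (lam : ℝ) (vstar : Fin d → ℝ) : Matrix (Fin d) (Fin d) ℝ :=
  lam • vecMulVec vstar vstar + 1

/-- `x 1, …, x n` are spiked Wishart samples with spike `v*`:
`x i = √λ g i • v* + z i` with `g, z` i.i.d. standard normal, mutually independent. -/
def IsSpikedWishart {d n : ℕ} {Ω : Type*} [MeasurableSpace Ω] (μ : Measure Ω)
    (lam : ℝ) (vstar : Fin d → ℝ) (x : Fin n → Ω → Fin d → ℝ) : Prop :=
  ∃ G : (Fin n ⊕ Fin n × Fin d) → Ω → ℝ,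
    (∀ i, Measurable (G i)) ∧
    iIndepFun G μ ∧
    (∀ i, μ.map (G i) = gaussianReal 0 1) ∧
    ∀ i ω j, x i ω j = Real.sqrt lam * G (Sum.inl i) ω * vstar j + G (Sum.inr (i, j)) ω

/-- The sample covariance matrix `n⁻¹ ∑ xᵢ xᵢᵀ`. -/
def sampleCov {d n : ℕ} {Ω : Type*} (x : Fin n → Ω → Fin d → ℝ) (ω : Ω) :
    Matrix (Fin d) (Fin d) ℝ :=
  (n : ℝ)⁻¹ • ∑ i, vecMulVec (x i ω) (x i ω)

/-- Union-of-linear-structures data: an orthonormal basis `φ` and subsets `Bs m`. -/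
structure UnionStruct (d M : ℕ) where
  φ : Fin d → Fin d → ℝ
  orthonormal : ∀ i j, ip (φ i) (φ j) = if i = j then 1 else 0
  Bs : Fin M → Finset (Fin d)

/-- The subspace `L m = span (B m)`. -/
def UnionStruct.L {d M : ℕ} (U : UnionStruct d M) (m : Fin M) : Submodule ℝ (Fin d → ℝ) :=
  Submodule.span ℝ (U.φ '' (U.Bs m : Set (Fin d)))

/-- The union `𝓜 = ⋃ m, L m`. -/
def UnionStruct.carrier {d M : ℕ} (U : UnionStruct d M) : Set (Fin d → ℝ) :=
  ⋃ m, (U.L m : Set (Fin d → ℝ))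

/-- A `(d,k)`-layered graph. -/
structure LayeredGraph (d k : ℕ) where
  vs : Fin d
  vt : Fin d
  hst : vs ≠ vt
  V : Fin k → Finset (Fin d)
  hvs : ∀ j, vs ∉ V j
  hvt : ∀ j, vt ∉ V j
  hdisj : ∀ j j', j ≠ j' → Disjoint (V j) (V j')
  hdvd : k ∣ (d - 2)
  hcard : ∀ j, (V j).card = (d - 2) / k
  hcover : ∀ i, i ≠ vs → i ≠ vt → ∃ j, i ∈ V j

/-- A member of `P^k`: contains `v_s`, `v_t` and exactly one vertex of each layer. -/
def LayeredGraph.IsPathSet {d k : ℕ} (G : LayeredGraph d k) (P : Finset (Fin d)) : Prop :=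
  G.vs ∈ P ∧ G.vt ∈ P ∧ ∀ j, (P ∩ G.V j).card = 1

/-- `v` is `k`-path-sparse. -/
def LayeredGraph.PathSparse {d k : ℕ} (G : LayeredGraph d k) (v : Fin d → ℝ) : Prop :=
  ∃ P, G.IsPathSet P ∧ ∀ i, v i ≠ 0 → i ∈ P

/-- A member of `T^k`: a `k`-element rooted connected subtree of the complete binary
tree on nodes `1, …, d` (node `i ≥ 2` has parent `i / 2`). -/
def IsTreeSet (d k : ℕ) (T : Finset ℕ) : Prop :=
  T.card = k ∧ 1 ∈ T ∧ (∀ i ∈ T, 1 ≤ i ∧ i ≤ d) ∧ ∀ i ∈ T, 2 ≤ i → i / 2 ∈ T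

/-- `v` is `k`-tree-sparse (coordinate `i : Fin d` corresponds to node `i + 1`). -/
def TreeSparse (d k : ℕ) (v : Fin d → ℝ) : Prop :=
  ∃ T, IsTreeSet d k T ∧ ∀ i : Fin d, v i ≠ 0 → (i : ℕ) + 1 ∈ T

/-- The index of the parent node: coordinate `i` is node `i+1`, whose parent is `(i+1)/2`. -/
def parentIdx {d : ℕ} (i : Fin d) : Fin d :=
  ⟨((i : ℕ) + 1) / 2 - 1, by have := i.isLt; omega⟩

/-- The feasible set of the SDP relaxation for tree-sparse PCA. -/
def sdpFeasible (d k : ℕ) : Set (Matrix (Fin d) (Fin d) ℝ) :=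
  {Mm | Mm.PosSemidef ∧ (∑ i, Mm i i) = 1 ∧ (∑ i, ∑ j, |Mm i j|) ≤ (k : ℝ) ∧
    ∀ i : Fin d, 2 ≤ (i : ℕ) + 1 → Mm i i ≤ Mm (parentIdx i) (parentIdx i)}


theorem nrm_sq {d : ℕ} (v : Fin d → ℝ) : nrm v ^ 2 = ip v v := by
  unfold nrm ip
  rw [Real.sq_sqrt (Finset.sum_nonneg fun i _ => sq_nonneg _)]
  exact Finset.sum_congr rfl fun i _ => by ring

theorem nrm_nonneg {d : ℕ} (v : Fin d → ℝ) : 0 ≤ nrm v := Real.sqrt_nonneg _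

theorem ip_eq {d : ℕ} (u v : Fin d → ℝ) : ip u v = u ⬝ᵥ v := rfl

theorem ip_comm' {d : ℕ} (u v : Fin d → ℝ) : ip u v = ip v u := by
  simp only [ip_eq, dotProduct_comm]

theorem ip_comb {d : ℕ} (a b : ℝ) (u v : Fin d → ℝ) :
    ip (a • u + b • v) (a • u + b • v) = a ^ 2 * ip u u + 2 * a * b * ip u v + b ^ 2 * ip v v := by
  simp only [ip_eq, add_dotProduct, dotProduct_add, smul_dotProduct, dotProduct_smul, smul_eq_mul,
    dotProduct_comm v u]
  ring

theorem quad_comb {d : ℕ} (A : Matrix (Fin d) (Fin d) ℝ) (a b : ℝ) (u v : Fin d → ℝ) :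
    quad A (a • u + b • v) = a ^ 2 * quad A u
      + a * b * (ip u (A.mulVec v) + ip v (A.mulVec u)) + b ^ 2 * quad A v := by
  simp only [quad, ip_eq, mulVec_add, mulVec_smul, add_dotProduct, dotProduct_add, smul_dotProduct,
    dotProduct_smul, smul_eq_mul]
  ring

theorem quad_smul' {d : ℕ} (A : Matrix (Fin d) (Fin d) ℝ) (a : ℝ) (u : Fin d → ℝ) :
    quad A (a • u) = a ^ 2 * quad A u := by
  simp only [quad, ip_eq, mulVec_smul, smul_dotProduct, dotProduct_smul, smul_eq_mul]
  ring

theorem quad_spiked {d : ℕ} (S : Matrix (Fin d) (Fin d) ℝ) (lam : ℝ) (u v : Fin d → ℝ) :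
    quad (S - spikedCov lam u) v = quad S v - lam * ip u v ^ 2 - ip v v := by
  simp only [quad, ip_eq, spikedCov, sub_mulVec, add_mulVec, smul_mulVec, one_mulVec,
    vecMulVec_mulVec, dotProduct_sub, dotProduct_add, dotProduct_smul, smul_eq_mul,
    dotProduct_comm v u, op_smul_eq_smul]
  ring

theorem rho_bdd {d : ℕ} (A : Matrix (Fin d) (Fin d) ℝ) (S : Set (Fin d → ℝ)) :
    BddAbove {x : ℝ | ∃ v ∈ S, nrm v = 1 ∧ x = |quad A v|} := by
  refine ⟨∑ i, ∑ j, |A i j|, ?_⟩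
  rintro x ⟨v, -, hv, rfl⟩
  have h1 : ∀ i, |v i| ≤ 1 := by
    intro i
    have h := nrm_sq v
    rw [hv] at h
    have h2 : v i * v i ≤ ip v v :=
      Finset.single_le_sum (f := fun i => v i * v i) (fun i _ => mul_self_nonneg _)
        (Finset.mem_univ i)
    rw [abs_le]
    constructor <;> nlinarith
  have : quad A v = ∑ i, ∑ j, v i * (A i j * v j) := by
    simp only [quad, ip, mulVec, dotProduct, Finset.mul_sum]
  rw [this]
  refine (Finset.abs_sum_le_sum_abs _ _).trans (Finset.sum_le_sum fun i _ => ?_)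
  refine (Finset.abs_sum_le_sum_abs _ _).trans (Finset.sum_le_sum fun j _ => ?_)
  rw [abs_mul, abs_mul]
  have h3 : |A i j| * |v j| ≤ |A i j| := mul_le_of_le_one_right (abs_nonneg _) (h1 j)
  exact (mul_le_of_le_one_left (by positivity) (h1 i)).trans h3

theorem quad_le_rho {d : ℕ} (A : Matrix (Fin d) (Fin d) ℝ) (F : Submodule ℝ (Fin d → ℝ))
    (v : Fin d → ℝ) (hv : v ∈ F) (hpos : 0 < ip v v) :
    |quad A v| ≤ rho A (F : Set (Fin d → ℝ)) * ip v v := by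
  rw [← nrm_sq] at hpos ⊢
  have hn : 0 < nrm v := lt_of_le_of_ne (nrm_nonneg v) fun h => by simp [← h] at hpos
  have hu : nrm ((nrm v)⁻¹ • v) = 1 := by
    have h : nrm ((nrm v)⁻¹ • v) ^ 2 = 1 := by
      rw [nrm_sq, ip_eq, smul_dotProduct, dotProduct_smul, ← ip_eq, ← nrm_sq, smul_eq_mul,
        smul_eq_mul]
      field_simp
    exact (pow_eq_one_iff_of_nonneg (nrm_nonneg _) two_ne_zero).1 h
  have h := le_csSup (rho_bdd A (F : Set (Fin d → ℝ)))
    ⟨(nrm v)⁻¹ • v, F.smul_mem _ hv, hu, rfl⟩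
  change _ ≤ rho A _ at h
  rw [quad_smul', abs_mul, abs_of_nonneg (by positivity : 0 ≤ (nrm v)⁻¹ ^ 2), inv_pow,
    inv_mul_le_iff₀ hpos] at h
  linarith

/-- Theorem 1(a): deterministic upper bound for the exhaustive
search estimator under the union-of-linear-structures condition. -/
theorem exhaustive_search_upper_bound
    {d M : ℕ} (U : UnionStruct d M)
    (vstar : Fin d → ℝ) (hvstar_mem : vstar ∈ U.carrier) (hvstar_nrm : nrm vstar = 1)
    (lam : ℝ) (hlam : 0 < lam)
    (Sighat : Matrix (Fin d) (Fin d) ℝ) (hSig : Sighat.IsSymm)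
    (W : Matrix (Fin d) (Fin d) ℝ) (hW : W = Sighat - spikedCov lam vstar)
    (vhat : Fin d → ℝ) (hvhat_mem : vhat ∈ U.carrier) (hvhat_nrm : nrm vhat = 1)
    (hmax : ∀ v ∈ U.carrier, nrm v = 1 → quad Sighat v ≤ quad Sighat vhat)
    (hpos : 0 ≤ ip vstar vhat)
    (mhat mstar : Fin M) (hmhat : vhat ∈ U.L mhat) (hmstar : vstar ∈ U.L mstar) :
    nrm (vhat - vstar) ≤
      (2 * Real.sqrt 2 / lam) * rho W ((U.L mhat ⊔ U.L mstar : Submodule ℝ (Fin d → ℝ)) : Set (Fin d → ℝ)) := by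
  set F := U.L mhat ⊔ U.L mstar with hF
  have hhF : vhat ∈ F := Submodule.mem_sup_left hmhat
  have hsF : vstar ∈ F := Submodule.mem_sup_right hmstar
  set r := rho W (F : Set (Fin d → ℝ)) with hr
  have hss : ip vstar vstar = 1 := by rw [← nrm_sq, hvstar_nrm]; norm_num
  have hhh : ip vhat vhat = 1 := by rw [← nrm_sq, hvhat_nrm]; norm_num
  have hm := hmax vstar hvstar_mem hvstar_nrm
  have q1 := quad_spiked Sighat lam vstar vhat
  have q2 := quad_spiked Sighat lam vstar vstar
  rw [← hW] at q1 q2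
  rw [hhh] at q1
  rw [hss] at q2
  set c := ip vstar vhat with hc
  have hc' : ip vhat vstar = c := ip_comm' _ _
  have hs2 : nrm (vhat - vstar) ^ 2 = 2 - 2 * c := by
    have h := ip_comb 1 (-1) vhat vstar
    rw [hss, hhh, hc', one_smul, neg_one_smul, ← sub_eq_add_neg] at h
    rw [nrm_sq, h]; ring
  have hs0 : 0 ≤ nrm (vhat - vstar) := nrm_nonneg _
  set s := nrm (vhat - vstar) with hs
  have hr0 : 0 ≤ r := by
    have h := quad_le_rho W F vhat hhF (by rw [hhh]; norm_num)
    rw [hhh, mul_one] at h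
    exact (abs_nonneg _).trans h
  rcases hs0.eq_or_lt with h0 | hspos
  · rw [← h0]; positivity
  obtain ⟨t, ht, ht2⟩ : ∃ t : ℝ, Real.sqrt 2 ≤ t ∧ t ^ 2 = 2 + 2 * c :=
    ⟨Real.sqrt (2 + 2 * c), Real.sqrt_le_sqrt (by linarith), Real.sq_sqrt (by linarith)⟩
  have h2pos : 0 < Real.sqrt 2 := by positivity
  have htpos : 0 < t := h2pos.trans_le ht
  have hst : s ^ 2 * t ^ 2 = 4 * (1 - c ^ 2) := by rw [hs2, ht2]; ring
  have hstpos : 0 < s ^ 2 * t ^ 2 := by positivity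
  have nx : ip ((t + s) • vhat + (s - t) • vstar) ((t + s) • vhat + (s - t) • vstar)
      = 2 * (s ^ 2 * t ^ 2) := by
    rw [ip_comb, hss, hhh, hc', hst]
    linear_combination (2 + 2 * c) * hs2 + (2 - 2 * c) * ht2
  have ny : ip ((t - s) • vhat + (-(t + s)) • vstar) ((t - s) • vhat + (-(t + s)) • vstar)
      = 2 * (s ^ 2 * t ^ 2) := by
    rw [ip_comb, hss, hhh, hc', hst]
    linear_combination (2 + 2 * c) * hs2 + (2 - 2 * c) * ht2
  have bx := (le_abs_self _).trans (quad_le_rho W F ((t + s) • vhat + (s - t) • vstar)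
    (F.add_mem (F.smul_mem _ hhF) (F.smul_mem _ hsF)) (by rw [nx]; positivity))
  have bY := (neg_abs_le _).trans' (neg_le_neg
    (quad_le_rho W F ((t - s) • vhat + (-(t + s)) • vstar)
    (F.add_mem (F.smul_mem _ hhF) (F.smul_mem _ hsF)) (by rw [ny]; positivity)))
  rw [nx, quad_comb] at bx
  rw [ny, quad_comb] at bY
  have hp : 0 < s * t := by positivity
  have k1 : (s * t) * (quad W vhat - quad W vstar) ≤ (s * t) * (r * (s * t)) := by
    change _ ≤ r * _ at bx
    change -(r * _) ≤ _ at bY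
    linarith
  have k2 := le_of_mul_le_mul_left k1 hp
  have k3 : lam * (s ^ 2 * t ^ 2) ≤ 4 * (r * (s * t)) := by
    rw [hst]; rw [q1, q2] at k2; linarith
  have k4 : (s * t) * (lam * (s * t)) ≤ (s * t) * (4 * r) := by linarith
  have k5 := le_of_mul_le_mul_left k4 hp
  have k6 : lam * s * Real.sqrt 2 ≤ lam * s * t := mul_le_mul_of_nonneg_left ht (by positivity)
  have k7 : Real.sqrt 2 * Real.sqrt 2 = 2 := Real.mul_self_sqrt (by norm_num)
  have k8 : (lam * s * Real.sqrt 2) * Real.sqrt 2 ≤ (4 * r) * Real.sqrt 2 :=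
    mul_le_mul_of_nonneg_right (by linarith) h2pos.le
  have k9 : lam * s * 2 ≤ 4 * r * Real.sqrt 2 := by
    calc lam * s * 2 = lam * s * Real.sqrt 2 * Real.sqrt 2 := by rw [mul_assoc (lam * s), k7]
      _ ≤ _ := k8
  rw [div_mul_eq_mul_div, le_div_iff₀ hlam]
  linarith

end StructuredPCA
end
end

section
/- Let Σ̂ be a symmetric d×d matrix, let v_t ∈ 𝓜 ∩ S^{d−1}, and let v_{t+1} be a maximizer of v ↦ ⟨v, Σ̂ v_t⟩ over 𝓜 ∩ S^{d−1}. Let L^{(t)}, L^{(t+1)}, L* ∈ {L_1, …, L_M} be subspaces containing v_t, v_{t+1}, and a fixed vector v* ∈ 𝓜 respectively, and set F := span(L^{(t)} ∪ L^{(t+1)} ∪ L*). Let P_F be the orthogonal projection onto F and Σ̂_F := P_F Σ̂ P_F. Then max_{v ∈ 𝓜 ∩ S^{d−1}} ⟨v, Σ̂ v_t⟩ = max_{v ∈ 𝓜 ∩ S^{d−1}} ⟨v, Σ̂_F v_t⟩, and v_{t+1} attains both maxima; in particular v_{t+1} is also a maximizer of v ↦ ⟨v, Σ̂_F v_t⟩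 over 𝓜 ∩ S^{d−1}. -/
open MeasureTheory ProbabilityTheory Matrix Finset

noncomputable section

namespace StructuredPCA

theorem aux_sq {d : ℕ} (v : Fin d → ℝ) : ∑ i, v i ^ 2 = v ⬝ᵥ v := by
  simp [dotProduct, sq]

theorem aux_nrm_one {d : ℕ} (v : Fin d → ℝ) : nrm v = 1 ↔ v ⬝ᵥ v = 1 := by
  unfold nrm
  rw [aux_sq, Real.sqrt_eq_one]

theorem aux_symm {d : ℕ} {P : Matrix (Fin d) (Fin d) ℝ} (hP : P.IsSymm) (u w : Fin d → ℝ) :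
    u ⬝ᵥ (P *ᵥ w) = (P *ᵥ u) ⬝ᵥ w := by
  rw [Matrix.dotProduct_mulVec]
  congr 1
  rw [← Matrix.mulVec_transpose, hP.eq]

theorem aux_span_zero {d M : ℕ} (U : UnionStruct d M) (m : Fin M) (i : Fin d)
    (hi : i ∉ U.Bs m) : ∀ w ∈ U.L m, U.φ i ⬝ᵥ w = 0 := by
  intro w hw
  unfold UnionStruct.L at hw
  induction hw using Submodule.span_induction with
  | mem x hx =>
    obtain ⟨j, hj, rfl⟩ := hx
    have := U.orthonormal i j
    rw [if_neg (by rintro rfl; exact hi (by simpa using hj))] at this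
    exact this
  | zero => simp
  | add x y _ _ hx hy => rw [dotProduct_add, hx, hy, add_zero]
  | smul a x _ hx => rw [dotProduct_smul, hx, smul_zero]

theorem aux_P {d M : ℕ} (U : UnionStruct d M) (mt mt1 ms : Fin M)
    (P : Matrix (Fin d) (Fin d) ℝ) (hPsymm : P.IsSymm)
    (hPrange : ∀ w : Fin d → ℝ, P.mulVec w ∈ U.L mt ⊔ U.L mt1 ⊔ U.L ms)
    (hPfix : ∀ w ∈ U.L mt ⊔ U.L mt1 ⊔ U.L ms, P.mulVec w = w) (i : Fin d) :
    P *ᵥ U.φ i = U.φ i ∨ P *ᵥ U.φ i = 0 := by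
  have hmem : ∀ m, i ∈ U.Bs m → U.φ i ∈ U.L m := fun m h =>
    Submodule.subset_span ⟨i, by simpa using h, rfl⟩
  by_cases h1 : i ∈ U.Bs mt
  · exact Or.inl (hPfix _ (Submodule.mem_sup_left (Submodule.mem_sup_left (hmem _ h1))))
  by_cases h2 : i ∈ U.Bs mt1
  · exact Or.inl (hPfix _ (Submodule.mem_sup_left (Submodule.mem_sup_right (hmem _ h2))))
  by_cases h3 : i ∈ U.Bs ms
  · exact Or.inl (hPfix _ (Submodule.mem_sup_right (hmem _ h3)))
  right
  rw [← dotProduct_self_eq_zero, ← aux_symm hPsymm, hPfix _ (hPrange _)]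
  obtain ⟨y, hy, c, hc, he⟩ := Submodule.mem_sup.1 (hPrange (U.φ i))
  obtain ⟨a, ha, b, hb, rfl⟩ := Submodule.mem_sup.1 hy
  rw [← he, dotProduct_add, dotProduct_add, aux_span_zero U _ i h1 a ha,
    aux_span_zero U _ i h2 b hb, aux_span_zero U _ i h3 c hc]
  simp

theorem aux_PL {d M : ℕ} (U : UnionStruct d M) (P : Matrix (Fin d) (Fin d) ℝ)
    (h : ∀ i, P *ᵥ U.φ i = U.φ i ∨ P *ᵥ U.φ i = 0) (m : Fin M) :
    ∀ u ∈ U.L m, P *ᵥ u ∈ U.L m := by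
  intro u hu
  unfold UnionStruct.L at hu
  induction hu using Submodule.span_induction with
  | mem x hx =>
    obtain ⟨j, hj, rfl⟩ := hx
    rcases h j with h | h
    · rw [h]; exact Submodule.subset_span ⟨j, hj, rfl⟩
    · rw [h]; exact Submodule.zero_mem _
  | zero => simp
  | add x y _ _ hx hy => rw [mulVec_add]; exact Submodule.add_mem _ hx hy
  | smul a x _ hx => rw [mulVec_smul]; exact Submodule.smul_mem _ _ hx

/-- equivalent replacement lemma: the projected power iterate is
unchanged if `Σ̂` is replaced by its restriction `Σ̂_F = P_F Σ̂ P_F`, where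
`F = span(L^{(t)} ∪ L^{(t+1)} ∪ L*)`; moreover the two maxima coincide. -/
theorem equivalent_replacement
    {d M : ℕ} (U : UnionStruct d M)
    (Sighat : Matrix (Fin d) (Fin d) ℝ)
    (vt : Fin d → ℝ) (hvt_mem : vt ∈ U.carrier) (hvt_nrm : nrm vt = 1)
    (vt1 : Fin d → ℝ) (hvt1_mem : vt1 ∈ U.carrier) (hvt1_nrm : nrm vt1 = 1)
    (hmax : ∀ u ∈ U.carrier, nrm u = 1 →
        ip u (Sighat.mulVec vt) ≤ ip vt1 (Sighat.mulVec vt))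
    (vstar : Fin d → ℝ) (hvstar_mem : vstar ∈ U.carrier)
    (mt mt1 ms : Fin M)
    (hmt : vt ∈ U.L mt) (hmt1 : vt1 ∈ U.L mt1) (hms : vstar ∈ U.L ms)
    (F : Submodule ℝ (Fin d → ℝ)) (hF : F = U.L mt ⊔ U.L mt1 ⊔ U.L ms)
    (P : Matrix (Fin d) (Fin d) ℝ) (hPsymm : P.IsSymm)
    (hPrange : ∀ w : Fin d → ℝ, P.mulVec w ∈ F)
    (hPfix : ∀ w ∈ F, P.mulVec w = w) :
    (∀ u ∈ U.carrier, nrm u = 1 →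
        ip u ((P * Sighat * P).mulVec vt) ≤ ip vt1 ((P * Sighat * P).mulVec vt)) ∧
      ip vt1 ((P * Sighat * P).mulVec vt) = ip vt1 (Sighat.mulVec vt) := by
  subst hF
  have hvtF := hPfix vt (Submodule.mem_sup_left (Submodule.mem_sup_left hmt))
  have hvt1F := hPfix vt1 (Submodule.mem_sup_left (Submodule.mem_sup_right hmt1))
  have key : ∀ u, ip u ((P * Sighat * P) *ᵥ vt) = ip (P *ᵥ u) (Sighat *ᵥ vt) := by
    intro u
    rw [← mulVec_mulVec, hvtF, ← mulVec_mulVec]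
    exact aux_symm hPsymm _ _
  have hcar : ∀ u, u ∈ U.carrier ↔ ∃ m, u ∈ U.L m := by
    intro u; simp [UnionStruct.carrier]
  have hpos : 0 ≤ ip vt1 (Sighat *ᵥ vt) := by
    have := hmax (-vt1) ((hcar _).2 ⟨mt1, Submodule.neg_mem _ hmt1⟩) (by
      rw [aux_nrm_one] at hvt1_nrm ⊢; simpa using hvt1_nrm)
    have h2 : ip (-vt1) (Sighat *ᵥ vt) = - ip vt1 (Sighat *ᵥ vt) := neg_dotProduct _ _
    linarith
  refine ⟨?_, by rw [key, hvt1F]⟩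
  intro u hu hun
  rw [key, key, hvt1F]
  obtain ⟨m, hm⟩ := (hcar u).1 hu
  have hPu := aux_PL U P (aux_P U mt mt1 ms P hPsymm hPrange hPfix) m u hm
  have hle : (P *ᵥ u) ⬝ᵥ (P *ᵥ u) ≤ 1 := by
    rw [aux_nrm_one] at hun
    have h1 : (P *ᵥ u) ⬝ᵥ (P *ᵥ u) = u ⬝ᵥ (P *ᵥ u) := by
      rw [← aux_symm hPsymm, hPfix _ (hPrange _)]
    have h2 : 0 ≤ (u - P *ᵥ u) ⬝ᵥ (u - P *ᵥ u) :=
      Finset.sum_nonneg fun i _ => mul_self_nonneg _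
    rw [dotProduct_sub, sub_dotProduct, sub_dotProduct, dotProduct_comm (P *ᵥ u) u] at h2
    linarith
  generalize P *ᵥ u = w at hPu hle
  by_cases hw : w = 0
  · subst hw
    have : ip 0 (Sighat *ᵥ vt) = 0 := zero_dotProduct _
    rw [this]; exact hpos
  have hwpos : 0 < w ⬝ᵥ w :=
    lt_of_le_of_ne (Finset.sum_nonneg fun i _ => mul_self_nonneg _)
      (fun h => hw (dotProduct_self_eq_zero.1 h.symm))
  set c := Real.sqrt (w ⬝ᵥ w) with hc
  have hcpos : 0 < c := Real.sqrt_pos.2 hwpos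
  have hc1 : c ≤ 1 := Real.sqrt_le_one.2 hle
  have hcc : c * c = w ⬝ᵥ w := Real.mul_self_sqrt hwpos.le
  have h3 := hmax (c⁻¹ • w) ((hcar _).2 ⟨m, Submodule.smul_mem _ _ hPu⟩) (by
    rw [aux_nrm_one, smul_dotProduct, dotProduct_smul, ← hcc]
    simp only [smul_eq_mul]
    field_simp)
  have h4 : ip (c⁻¹ • w) (Sighat *ᵥ vt) = c⁻¹ * ip w (Sighat *ᵥ vt) := smul_dotProduct _ _ _
  rw [h4, inv_mul_le_iff₀ hcpos] at h3
  exact h3.trans (mul_le_of_le_one_left hpos hc1)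

end StructuredPCA
end
end

section
/- Suppose |B_m| = k for all m ∈ [M] with k ≥ 2. Then for any ξ ∈ [3/4, 1) and any ε ∈ (0,1), there exists a finite set V_ε ⊆ S^{d−1} ∩ 𝓜 such that √(2(1−ξ)) · ε ≤ ‖v − v'‖₂ ≤ √2 · ε for all distinct v, v' ∈ V_ε, and |V_ε| ≥ |Z*| / max_{z ∈ Z*} |N_H(z; 2(1−ξ)k)|. -/
open MeasureTheory ProbabilityTheory Matrix Finset

noncomputable section

namespace StructuredPCA

lemma aux_comb_sq {d : ℕ} (φ : Fin d → Fin d → ℝ)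
    (h : ∀ i j, ip (φ i) (φ j) = if i = j then 1 else 0) (c : Fin d → ℝ) :
    ∑ j, (∑ i, c i • φ i) j ^ 2 = ∑ i, c i ^ 2 := by
  have h1 : ∀ j, (∑ i, c i • φ i) j ^ 2 = ∑ i, ∑ l, c i * c l * (φ i j * φ l j) := by
    intro j
    rw [Finset.sum_apply, sq, Finset.sum_mul_sum]
    refine Finset.sum_congr rfl fun i _ => Finset.sum_congr rfl fun l _ => ?_
    simp only [Pi.smul_apply, smul_eq_mul]; ring
  simp_rw [h1]
  rw [Finset.sum_comm]
  refine Finset.sum_congr rfl fun i _ => ?_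
  rw [Finset.sum_comm]
  have h2 : ∀ l, ∑ j, c i * c l * (φ i j * φ l j) = if i = l then c i * c l else 0 := by
    intro l
    rw [← Finset.mul_sum]
    have := h i l
    unfold ip at this
    rw [this]; split_ifs <;> simp
  simp_rw [h2]
  simp [sq]

/-- Greedy packing: a maximal separated subset covers. -/
lemma aux_packing {α : Type*} [Fintype α] [DecidableEq α] (Z : Finset α) (R : α → α → Prop)
    [DecidableRel R] (hrefl : ∀ a, R a a) (hsymm : ∀ a b, R a b → R b a) :
    ∃ P ⊆ Z, (∀ a ∈ P, ∀ b ∈ P, a ≠ b → ¬ R a b) ∧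
      Z.card ≤ P.card * (Z.sup fun m => (Z.filter fun b => R m b).card) := by
  classical
  obtain ⟨P, hP, hmax⟩ := Finset.exists_max_image
    (Z.powerset.filter fun P => ∀ a ∈ P, ∀ b ∈ P, a ≠ b → ¬ R a b) Finset.card
    ⟨∅, by simp⟩
  simp only [Finset.mem_filter, Finset.mem_powerset] at hP hmax
  refine ⟨P, hP.1, hP.2, ?_⟩
  have hcov : Z ⊆ P.biUnion fun m => Z.filter fun b => R m b := by
    intro z hz
    by_contra hcon
    simp only [Finset.mem_biUnion, Finset.mem_filter, not_exists, not_and] at hcon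
    have hzP : z ∉ P := fun h => hcon z h hz (hrefl z)
    have := hmax (insert z P) ⟨Finset.insert_subset hz hP.1, by
      intro a ha b hb hab
      rw [Finset.mem_insert] at ha hb
      rcases ha with rfl | ha <;> rcases hb with rfl | hb
      · exact absurd rfl hab
      · exact fun h => hcon b hb hz (hsymm _ _ h)
      · exact hcon a ha hz
      · exact hP.2 a ha b hb hab⟩
    rw [Finset.card_insert_of_notMem hzP] at this
    omega
  calc Z.card ≤ _ := Finset.card_le_card hcov
    _ ≤ _ := Finset.card_biUnion_le_card_mul _ _ _ fun a ha =>
      Finset.le_sup (f := fun m => (Z.filter fun b => R m b).card) (hP.1 ha)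

/-- coefficient vector -/
def auxC {d : ℕ} (i0 : Fin d) (B : Finset (Fin d)) (a b : ℝ) (i : Fin d) : ℝ :=
  if i = i0 then a else if i ∈ B then b else 0

lemma auxC_sq {d : ℕ} (i0 : Fin d) (B : Finset (Fin d)) (h : i0 ∈ B) (a b : ℝ) :
    ∑ i, auxC i0 B a b i ^ 2 = a ^ 2 + ((B.card : ℝ) - 1) * b ^ 2 := by
  have : ∀ i, auxC i0 B a b i ^ 2 =
      (if i = i0 then a ^ 2 - b ^ 2 else 0) + (if i ∈ B then b ^ 2 else 0) := by
    intro i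
    unfold auxC
    by_cases hi : i = i0
    · subst hi; simp [h]
    · by_cases hB : i ∈ B <;> simp [hi, hB]
  simp_rw [this]
  rw [Finset.sum_add_distrib]
  simp
  ring

lemma auxC_diff {d : ℕ} (i0 : Fin d) (B B' : Finset (Fin d)) (h : i0 ∈ B) (h' : i0 ∈ B')
    (a b : ℝ) :
    ∑ i, (auxC i0 B a b i - auxC i0 B' a b i) ^ 2 = ((symmDiff B B').card : ℝ) * b ^ 2 := by
  have : ∀ i, (auxC i0 B a b i - auxC i0 B' a b i) ^ 2 =
      (if i ∈ symmDiff B B' then b ^ 2 else 0) := by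
    intro i
    unfold auxC
    by_cases hi : i = i0
    · subst hi; simp [h, h', Finset.mem_symmDiff]
    · by_cases hB : i ∈ B <;> by_cases hB' : i ∈ B' <;> simp [hi, hB, hB', Finset.mem_symmDiff]
  simp_rw [this]
  simp

lemma aux_symm_card {d : ℕ} (i0 : Fin d) (B B' : Finset (Fin d)) (h : i0 ∈ B) (h' : i0 ∈ B')
    (k : ℕ) (hB : B.card = k) (hB' : B'.card = k) : (symmDiff B B').card + 2 ≤ 2 * k := by
  have h1 : (symmDiff B B').card ≤ ((B.erase i0) ∪ (B'.erase i0)).card := by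
    apply Finset.card_le_card
    intro i hi
    have : i ≠ i0 := by
      rintro rfl; simp [Finset.mem_symmDiff, h, h'] at hi
    simp only [Finset.mem_symmDiff] at hi
    simp only [Finset.mem_union, Finset.mem_erase]
    tauto
  have h2 := Finset.card_union_le (B.erase i0) (B'.erase i0)
  rw [Finset.card_erase_of_mem h, Finset.card_erase_of_mem h'] at h2
  have := Finset.card_pos.2 ⟨i0, h⟩
  omega

/-- local packing lemma: for any `ξ ∈ [3/4, 1)` and `ε ∈ (0,1)`
there is a packing `V_ε ⊆ S^{d-1} ∩ 𝓜` with pairwise distances in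
`[√(2(1−ξ))ε, √2 ε]` and `|V_ε| ≥ |Z*| / max_{z ∈ Z*} |N_H(z; 2(1−ξ)k)|`.
As in Statement 1, `Z*` is identified with the set of indices `m` with `i* ∈ B m`. -/
theorem local_packing
    {d M : ℕ} (U : UnionStruct d M)
    (hdistinct : Function.Injective U.Bs)
    (hM : 0 < M)
    (k : ℕ) (hk : 2 ≤ k) (hcard : ∀ m, (U.Bs m).card = k)
    (istar : Fin d)
    (histar : ∀ i : Fin d,
      (Finset.univ.filter fun m => i ∈ U.Bs m).card ≤
        (Finset.univ.filter fun m => istar ∈ U.Bs m).card)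
    (ξ : ℝ) (hξ1 : 3 / 4 ≤ ξ) (hξ2 : ξ < 1)
    (ε : ℝ) (hε0 : 0 < ε) (hε1 : ε < 1) :
    ∃ Vε : Finset (Fin d → ℝ),
      (∀ v ∈ Vε, v ∈ U.carrier ∧ nrm v = 1) ∧
      (∀ v ∈ Vε, ∀ v' ∈ Vε, v ≠ v' →
        Real.sqrt (2 * (1 - ξ)) * ε ≤ nrm (v - v') ∧ nrm (v - v') ≤ Real.sqrt 2 * ε) ∧
      (((Finset.univ.filter fun m => istar ∈ U.Bs m).card : ℕ) : ℝ) /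
          (((Finset.univ.filter fun m => istar ∈ U.Bs m).sup fun m =>
            ((Finset.univ.filter fun m' => istar ∈ U.Bs m' ∧
              ((symmDiff (U.Bs m) (U.Bs m')).card : ℝ) ≤ 2 * (1 - ξ) * k).card) : ℕ) : ℝ)
        ≤ (Vε.card : ℝ) := by
  classical
  set Z : Finset (Fin M) := Finset.univ.filter fun m => istar ∈ U.Bs m with hZ
  obtain ⟨P, hPZ, hPsep, hPcard⟩ := aux_packing Z
    (fun m m' => ((symmDiff (U.Bs m) (U.Bs m')).card : ℝ) ≤ 2 * (1 - ξ) * k)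
    (by intro a
        have : (0 : ℝ) ≤ 2 * (1 - ξ) * k := by
          have : 0 ≤ 1 - ξ := by linarith
          positivity
        simpa using this)
    (by intro a b h; rwa [symmDiff_comm])
  have hk1 : (0 : ℝ) < (k : ℝ) - 1 := by
    have : (2 : ℝ) ≤ k := by exact_mod_cast hk
    linarith
  set a : ℝ := Real.sqrt (1 - ε ^ 2) with ha
  set b : ℝ := ε / Real.sqrt ((k : ℝ) - 1) with hb
  have ha2 : a ^ 2 = 1 - ε ^ 2 := Real.sq_sqrt (by nlinarith)
  have hb2 : b ^ 2 = ε ^ 2 / ((k : ℝ) - 1) := by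
    rw [hb, div_pow, Real.sq_sqrt hk1.le]
  have hmem : ∀ m ∈ P, istar ∈ U.Bs m := fun m hm => by
    simpa [hZ] using hPZ hm
  let w : Fin M → Fin d → ℝ := fun m => ∑ i, auxC istar (U.Bs m) a b i • U.φ i
  have hdiff : ∀ m ∈ P, ∀ m' ∈ P, nrm (w m - w m') =
      Real.sqrt (((symmDiff (U.Bs m) (U.Bs m')).card : ℝ) * b ^ 2) := by
    intro m hm m' hm'
    have : w m - w m' =
        ∑ i, (auxC istar (U.Bs m) a b i - auxC istar (U.Bs m') a b i) • U.φ i := by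
      simp only [w, sub_smul, Finset.sum_sub_distrib]
    unfold nrm
    rw [this, aux_comb_sq U.φ U.orthonormal, auxC_diff _ _ _ (hmem m hm) (hmem m' hm')]
  have hlow : ∀ m ∈ P, ∀ m' ∈ P, m ≠ m' →
      Real.sqrt (2 * (1 - ξ)) * ε ≤ nrm (w m - w m') := by
    intro m hm m' hm' hne
    rw [hdiff m hm m' hm']
    have hs := not_le.1 (hPsep m hm m' hm' hne)
    apply Real.le_sqrt_of_sq_le
    rw [mul_pow, Real.sq_sqrt (by linarith), hb2, ← mul_div_assoc, le_div_iff₀ hk1]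
    have hε2 : 0 < ε ^ 2 := by positivity
    nlinarith [mul_lt_mul_of_pos_right hs hε2, mul_pos (sub_pos.2 hξ2) hε2]
  have hinj : Set.InjOn w P := by
    intro m hm m' hm' hw
    by_contra hne
    have h1 := hlow m hm m' hm' hne
    have h2 : nrm (w m - w m') = 0 := by rw [hw]; simp [nrm]
    have h3 : 0 < Real.sqrt (2 * (1 - ξ)) := Real.sqrt_pos.2 (by linarith)
    have := mul_pos h3 hε0
    linarith
  refine ⟨P.image w, ?_, ?_, ?_⟩
  · intro v hv
    obtain ⟨m, hm, rfl⟩ := Finset.mem_image.1 hv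
    constructor
    · refine Set.mem_iUnion.2 ⟨m, ?_⟩
      refine Submodule.sum_mem _ fun i _ => ?_
      by_cases hi : i ∈ U.Bs m
      · exact Submodule.smul_mem _ _ (Submodule.subset_span ⟨i, hi, rfl⟩)
      · have : auxC istar (U.Bs m) a b i = 0 := by
          have hne : i ≠ istar := by
            rintro rfl; exact hi (hmem m hm)
          simp [auxC, hne, hi]
        rw [this, zero_smul]
        exact Submodule.zero_mem _
    · unfold nrm
      rw [aux_comb_sq U.φ U.orthonormal, auxC_sq _ _ (hmem m hm), hcard, ha2, hb2,
        mul_div_cancel₀ _ hk1.ne']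
      simp
  · intro v hv v' hv' hne
    obtain ⟨m, hm, rfl⟩ := Finset.mem_image.1 hv
    obtain ⟨m', hm', rfl⟩ := Finset.mem_image.1 hv'
    refine ⟨hlow m hm m' hm' (fun h => hne (by rw [h])), ?_⟩
    rw [hdiff m hm m' hm']
    have hc := aux_symm_card istar _ _ (hmem m hm) (hmem m' hm') k (hcard m) (hcard m')
    have hc' : ((symmDiff (U.Bs m) (U.Bs m')).card : ℝ) + 2 ≤ 2 * k := by exact_mod_cast hc
    apply Real.sqrt_le_iff.2
    refine ⟨by positivity, ?_⟩
    rw [mul_pow, Real.sq_sqrt (by norm_num), hb2, ← mul_div_assoc, div_le_iff₀ hk1]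
    nlinarith [sq_nonneg ε]
  · rw [Finset.card_image_of_injOn hinj]
    have hfil : ∀ m, (Finset.univ.filter fun m' => istar ∈ U.Bs m' ∧
        ((symmDiff (U.Bs m) (U.Bs m')).card : ℝ) ≤ 2 * (1 - ξ) * k) =
        Z.filter fun m' => ((symmDiff (U.Bs m) (U.Bs m')).card : ℝ) ≤ 2 * (1 - ξ) * k := by
      intro m; rw [hZ, Finset.filter_filter]
    simp_rw [hfil]
    apply div_le_of_le_mul₀ (by positivity) (by positivity)
    exact_mod_cast hPcard

end StructuredPCA
end
end

section
/- There exists a universal constant c > 0 such that the following holds. Let d ≥ k ≥ 2 and n ≥ 1 be integers with (d/k³)^{k/2} ≥ 16d, and let λ > 0. Then for every measurable estimator v̂ : (ℝ^d)^n → ℝ^d there exists a unit vector v* ∈ ℝ^d with ‖v*‖₀ ≤ k such that, with x_1, …, x_n the spiked Wishart samples with spike v*, E[‖v̂(x_1,…,x_n) v̂(x_1,…,x_n)ᵀ − v* v*ᵀ‖_F] ≥ c · min{ 1 , √((1+λ)/(8λ²)) · √( k log d / n ) }. -/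
open MeasureTheory ProbabilityTheory Matrix Finset

noncomputable section

namespace StructuredPCA

/-- Standard Gaussian product measure. -/
def gam (ι : Type) [Fintype ι] : Measure (ι → ℝ) := Measure.pi fun _ => gaussianReal 0 1

instance (ι : Type) [Fintype ι] : IsProbabilityMeasure (gam ι) := by
  unfold gam; infer_instance

/-- The density of `gam`. -/
def gdens (ι : Type) [Fintype ι] (x : ι → ℝ) : ENNReal :=
  ENNReal.ofReal ((Real.sqrt (2 * Real.pi))⁻¹ ^ Fintype.card ι * Real.exp (-(∑ i, x i ^ 2) / 2))

lemma gdens_eq (ι : Type) [Fintype ι] (x : ι → ℝ) :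
    gdens ι x = ENNReal.ofReal (∏ i, gaussianPDFReal 0 1 (x i)) := by
  unfold gdens gaussianPDFReal
  congr 1
  rw [Finset.prod_mul_distrib, ← Real.exp_sum]
  simp [Finset.sum_div, neg_div]

lemma measurable_gdens (ι : Type) [Fintype ι] : Measurable (gdens ι) := by
  unfold gdens; fun_prop

lemma gam_eq (ι : Type) [Fintype ι] : gam ι = volume.withDensity (gdens ι) := by
  symm
  unfold gam
  symm
  refine Measure.pi_eq (fun s hs => ?_)
  rw [withDensity_apply _ (MeasurableSet.univ_pi hs), volume_pi, Measure.restrict_pi_pi]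
  simp_rw [gdens_eq]
  rw [← ofReal_integral_eq_lintegral_ofReal, integral_fintype_prod_eq_prod, ENNReal.ofReal_prod_of_nonneg]
  · refine Finset.prod_congr rfl fun i _ => ?_
    rw [gaussianReal_apply_eq_integral _ (by norm_num)]
  · intro i _
    exact integral_nonneg fun x => gaussianPDFReal_nonneg _ _ _
  · refine Integrable.fintype_prod (f := fun _ => gaussianPDFReal 0 1) (fun i => ?_)
    exact (integrable_gaussianPDFReal 0 1).restrict
  · exact Filter.Eventually.of_forall fun x => Finset.prod_nonneg fun i _ => gaussianPDFReal_nonneg _ _ _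

/-- The sample map. -/
def Xmap {n d : ℕ} (lam : ℝ) (v : Fin d → ℝ) (w : Fin n ⊕ Fin n × Fin d → ℝ) :
    Fin n → Fin d → ℝ :=
  fun i j => Real.sqrt lam * w (Sum.inl i) * v j + w (Sum.inr (i, j))

lemma measurable_Xmap {n d : ℕ} (lam : ℝ) (v : Fin d → ℝ) :
    Measurable (Xmap (n := n) lam v) := by
  unfold Xmap; fun_prop

/-- The law of the samples. -/
def PP {d : ℕ} (n : ℕ) (lam : ℝ) (v : Fin d → ℝ) : Measure (Fin n → Fin d → ℝ) :=
  (gam (Fin n ⊕ Fin n × Fin d)).map (Xmap lam v)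

instance {d : ℕ} (n : ℕ) (lam : ℝ) (v : Fin d → ℝ) : IsProbabilityMeasure (PP n lam v) :=
  Measure.isProbabilityMeasure_map (measurable_Xmap lam v).aemeasurable

lemma map_of_isSpiked {d n : ℕ} {Ω : Type} [MeasurableSpace Ω] (μ : Measure Ω)
    [IsProbabilityMeasure μ]
    (lam : ℝ) (v : Fin d → ℝ) (x : Fin n → Ω → Fin d → ℝ) (h : IsSpikedWishart μ lam v x) :
    Measurable (fun ω i => x i ω) ∧ μ.map (fun ω i => x i ω) = PP n lam v := by
  obtain ⟨G, hG, hI, hd, hx⟩ := h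
  have hx' : (fun ω i => x i ω) = Xmap lam v ∘ (fun ω i => G i ω) := by
    funext ω i j
    exact hx i ω j
  have hGm : Measurable (fun ω i => G i ω) := measurable_pi_lambda _ hG
  rw [hx']
  refine ⟨(measurable_Xmap lam v).comp hGm, ?_⟩
  rw [← Measure.map_map (measurable_Xmap lam v) hGm,
    (iIndepFun_iff_map_fun_eq_pi_map (fun i => (hG i).aemeasurable)).1 hI]
  unfold PP gam
  simp_rw [hd]

lemma lintegral_PP {d : ℕ} (n : ℕ) (lam : ℝ) (hl : 0 < lam) :
    ∃ C : ENNReal, ∀ v : Fin d → ℝ, ∑ j, v j ^ 2 = 1 →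
      ∀ F : (Fin n → Fin d → ℝ) → ENNReal, Measurable F →
      ∫⁻ x, F x ∂(PP n lam v) = C * ∫⁻ y : Fin n × Fin d → ℝ, F (fun i j => y (i, j)) *
        ENNReal.ofReal (Real.exp (-(∑ q, y q ^ 2) / 2 +
          lam / (1 + lam) / 2 * ∑ i, (∑ j, v j * y (i, j)) ^ 2)) := by
  set K1 := ENNReal.ofReal ((Real.sqrt (2 * Real.pi))⁻¹ ^ Fintype.card (Fin n)) with hK1
  set K2 := ENNReal.ofReal ((Real.sqrt (2 * Real.pi))⁻¹ ^ Fintype.card (Fin n × Fin d)) with hK2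
  set C0 := ∫⁻ g : Fin n → ℝ, ENNReal.ofReal (Real.exp (-((1 + lam) / 2 * ∑ i, g i ^ 2))) with hC0
  refine ⟨K1 * K2 * C0, fun v hv F hF => ?_⟩
  have e := measurePreserving_sumPiEquivProdPi
    (fun _ : Fin n ⊕ Fin n × Fin d => gaussianReal 0 1)
  have hXm := measurable_Xmap (n := n) lam v
  unfold PP
  rw [lintegral_map hF hXm]
  set Sh : (Fin n → ℝ) → (Fin n × Fin d → ℝ) := fun g q => Real.sqrt lam * g q.1 * v q.2 with hSh
  have hShm : Measurable Sh := by rw [hSh]; fun_prop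
  set Fc : (Fin n × Fin d → ℝ) → ENNReal := fun y => F (fun i j => y (i, j)) with hFc
  have hFcm : Measurable Fc := by rw [hFc]; fun_prop
  have h1 : ∫⁻ w, F (Xmap lam v w) ∂(gam (Fin n ⊕ Fin n × Fin d)) =
      ∫⁻ p : (Fin n → ℝ) × (Fin n × Fin d → ℝ), Fc (Sh p.1 + p.2)
        ∂((gam (Fin n)).prod (gam (Fin n × Fin d))) := by
    unfold gam
    rw [← e.map_eq, lintegral_map (by fun_prop) e.measurable]
    rfl
  rw [h1, lintegral_prod _ (by fun_prop)]
  have h2 : ∀ g : Fin n → ℝ, ∫⁻ z, Fc (Sh g + z) ∂(gam (Fin n × Fin d)) =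
      ∫⁻ y, gdens _ (y - Sh g) * Fc y := by
    intro g
    rw [gam_eq, lintegral_withDensity_eq_lintegral_mul _ (measurable_gdens _) (by fun_prop)]
    rw [← lintegral_sub_right_eq_self _ (Sh g)]
    simp
  simp_rw [h2]
  have hgd := measurable_gdens (Fin n × Fin d)
  have hgd1 := measurable_gdens (Fin n)
  rw [gam_eq, lintegral_withDensity_eq_lintegral_mul _ (measurable_gdens _) (by
    apply Measurable.lintegral_prod_right'
      (f := fun p : (Fin n → ℝ) × (Fin n × Fin d → ℝ) => gdens _ (p.2 - Sh p.1) * Fc p.2)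
    fun_prop)]
  simp only [Pi.mul_apply]
  have h3 : ∀ g : Fin n → ℝ, gdens (Fin n) g * ∫⁻ y, gdens _ (y - Sh g) * Fc y =
      ∫⁻ y, gdens (Fin n) g * (gdens _ (y - Sh g) * Fc y) := by
    intro g
    rw [lintegral_const_mul]
    have : Measurable (fun y : Fin n × Fin d → ℝ => y - Sh g) := by fun_prop
    exact (hgd.comp this).mul hFcm
  have h5 : Measurable (fun p : (Fin n → ℝ) × (Fin n × Fin d → ℝ) =>
      gdens (Fin n) p.1 * (gdens _ (p.2 - Sh p.1) * Fc p.2)) := by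
    have : Measurable (fun p : (Fin n → ℝ) × (Fin n × Fin d → ℝ) => p.2 - Sh p.1) :=
      measurable_snd.sub (hShm.comp measurable_fst)
    exact (hgd1.comp measurable_fst).mul ((hgd.comp this).mul (hFcm.comp measurable_snd))
  rw [lintegral_congr h3, lintegral_lintegral_swap h5.aemeasurable]
  have h4 : ∀ y : Fin n × Fin d → ℝ,
      ∫⁻ g : Fin n → ℝ, gdens (Fin n) g * (gdens _ (y - Sh g) * Fc y) =
      K1 * K2 * C0 * (Fc y * ENNReal.ofReal (Real.exp (-(∑ q, y q ^ 2) / 2 +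
          lam / (1 + lam) / 2 * ∑ i, (∑ j, v j * y (i, j)) ^ 2))) := by
    intro y
    set E := ENNReal.ofReal (Real.exp (-(∑ q, y q ^ 2) / 2 +
          lam / (1 + lam) / 2 * ∑ i, (∑ j, v j * y (i, j)) ^ 2)) with hE
    set s : Fin n → ℝ := fun i => Real.sqrt lam * (∑ j, v j * y (i, j)) / (1 + lam) with hs
    have hp : ∀ g : Fin n → ℝ, gdens (Fin n) g * (gdens _ (y - Sh g) * Fc y) =
        (K1 * K2 * (Fc y * E)) *
          ENNReal.ofReal (Real.exp (-((1 + lam) / 2 * ∑ i, (g - s) i ^ 2))) := by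
      intro g
      have hexp : -(∑ i, g i ^ 2) / 2 + -(∑ q, (y - Sh g) q ^ 2) / 2 =
          (-(∑ q, y q ^ 2) / 2 + lam / (1 + lam) / 2 * ∑ i, (∑ j, v j * y (i, j)) ^ 2) +
          -((1 + lam) / 2 * ∑ i, (g - s) i ^ 2) := by
        rw [Fintype.sum_prod_type, Fintype.sum_prod_type]
        have : ∀ i, ∑ j, (y - Sh g) (i, j) ^ 2 = ∑ j, y (i, j) ^ 2
            - 2 * Real.sqrt lam * g i * (∑ j, v j * y (i, j)) + lam * g i ^ 2 := by
          intro i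
          calc ∑ j, (y - Sh g) (i, j) ^ 2 = ∑ j, (y (i, j) ^ 2
                - 2 * Real.sqrt lam * g i * (v j * y (i, j)) + lam * g i ^ 2 * v j ^ 2) := by
                refine Finset.sum_congr rfl fun j _ => ?_
                simp only [hSh, Pi.sub_apply]
                have := Real.sq_sqrt hl.le
                linear_combination (g i ^ 2 * v j ^ 2) * this
            _ = _ := by
                rw [Finset.sum_add_distrib, Finset.sum_sub_distrib, ← Finset.mul_sum,
                  ← Finset.mul_sum, hv, mul_one]
        simp_rw [this]
        rw [neg_div, neg_div, neg_div, Finset.sum_div, Finset.sum_div, Finset.sum_div,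
          Finset.mul_sum, Finset.mul_sum, ← Finset.sum_neg_distrib, ← Finset.sum_neg_distrib,
          ← Finset.sum_neg_distrib, ← Finset.sum_neg_distrib, ← Finset.sum_add_distrib,
          ← Finset.sum_add_distrib, ← Finset.sum_add_distrib]
        refine Finset.sum_congr rfl fun i _ => ?_
        simp only [hs, Pi.sub_apply]
        have h7 := Real.sq_sqrt hl.le
        have h8 : (1 + lam) ≠ 0 := by positivity
        field_simp
        linear_combination ((∑ j, v j * y (i, j)) ^ 2) * h7
      have hE2 : ENNReal.ofReal (Real.exp (-(∑ i, g i ^ 2) / 2)) *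
          ENNReal.ofReal (Real.exp (-(∑ q, (y - Sh g) q ^ 2) / 2)) =
          E * ENNReal.ofReal (Real.exp (-((1 + lam) / 2 * ∑ i, (g - s) i ^ 2))) := by
        rw [← ENNReal.ofReal_mul (Real.exp_pos _).le, ← Real.exp_add, hexp, Real.exp_add,
          ENNReal.ofReal_mul (Real.exp_pos _).le]
      unfold gdens
      rw [ENNReal.ofReal_mul (by positivity), ENNReal.ofReal_mul (by positivity)]
      calc _ = K1 * K2 * Fc y * (ENNReal.ofReal (Real.exp (-(∑ i, g i ^ 2) / 2)) *
          ENNReal.ofReal (Real.exp (-(∑ q, (y - Sh g) q ^ 2) / 2))) := by ring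
        _ = _ := by rw [hE2]; ring
    rw [lintegral_congr hp, lintegral_const_mul _ (by fun_prop),
      lintegral_sub_right_eq_self
        (fun g : Fin n → ℝ => ENNReal.ofReal (Real.exp (-((1 + lam) / 2 * ∑ i, g i ^ 2)))) s]
    ring
  rw [lintegral_congr h4, lintegral_const_mul]
  exact hFcm.mul (by fun_prop)

/-- Log-likelihood ratio. -/
def llr {d n : ℕ} (lam : ℝ) (v u : Fin d → ℝ) (x : Fin n → Fin d → ℝ) : ℝ :=
  lam / (1 + lam) / 2 * (∑ i, (∑ j, v j * x i j) ^ 2 - ∑ i, (∑ j, u j * x i j) ^ 2)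

lemma measurable_llr {d n : ℕ} (lam : ℝ) (v u : Fin d → ℝ) :
    Measurable (llr (n := n) lam v u) := by
  unfold llr; fun_prop

lemma PP_change {d : ℕ} (n : ℕ) (lam : ℝ) (hl : 0 < lam) (v u : Fin d → ℝ)
    (hv : ∑ j, v j ^ 2 = 1) (hu : ∑ j, u j ^ 2 = 1)
    (F : (Fin n → Fin d → ℝ) → ENNReal) (hF : Measurable F) :
    ∫⁻ x, F x ∂(PP n lam v) =
      ∫⁻ x, F x * ENNReal.ofReal (Real.exp (llr lam v u x)) ∂(PP n lam u) := by
  obtain ⟨C, hC⟩ := lintegral_PP (d := d) n lam hl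
  have hm := measurable_llr (n := n) lam v u
  rw [hC v hv F hF, hC u hu _ (by fun_prop)]
  congr 1
  refine lintegral_congr fun y => ?_
  rw [mul_assoc, ← ENNReal.ofReal_mul (Real.exp_pos _).le, ← Real.exp_add]
  congr 3
  unfold llr
  ring

lemma gam_second (ι : Type) [Fintype ι] (a : ι → ℝ) :
    Integrable (fun w : ι → ℝ => (∑ i, a i * w i) ^ 2) (gam ι) ∧
    ∫ w, (∑ i, a i * w i) ^ 2 ∂(gam ι) = ∑ i, a i ^ 2 := by
  have hL : ∀ i, MemLp (fun x : ℝ => a i * x) 2 (gaussianReal 0 1) := fun i =>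
    (memLp_id_gaussianReal' 2 (by simp)).const_mul (a i)
  have hL2 : ∀ i, MemLp (fun w : ι → ℝ => a i * w i) 2 (gam ι) := fun i =>
    (hL i).comp_measurePreserving (measurePreserving_eval (fun _ : ι => gaussianReal 0 1) i)
  have hS : MemLp (fun w : ι → ℝ => ∑ i, a i * w i) 2 (gam ι) :=
    memLp_finsetSum _ fun i _ => hL2 i
  refine ⟨hS.integrable_sq, ?_⟩
  have hmean : ∫ w, (∑ i, a i * w i) ∂(gam ι) = 0 := by
    rw [integral_finsetSum _ fun i _ => (hL2 i).integrable (by norm_num)]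
    refine Finset.sum_eq_zero fun i _ => ?_
    rw [integral_const_mul]
    have : ∫ w : ι → ℝ, w i ∂(gam ι) = ∫ x, x ∂(gaussianReal 0 1) := by
      unfold gam
      exact integral_comp_eval (μ := fun _ : ι => gaussianReal 0 1) (f := fun x : ℝ => x) (i := i) 
        (by fun_prop)
    rw [this, integral_id_gaussianReal, mul_zero]
  have hv := variance_sum_pi (X := fun i (x : ℝ) => a i * x) hL
  have h2 : (∑ i, fun w : ι → ℝ => a i * w i) = fun w : ι → ℝ => ∑ i, a i * w i := by
    funext w; simp
  rw [h2] at hv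
  have h3 := variance_of_integral_eq_zero hS.aemeasurable hmean
  unfold gam at *
  rw [← h3, hv]
  refine Finset.sum_congr rfl fun i _ => ?_
  rw [variance_const_mul]
  have : Var[fun x : ℝ => x; gaussianReal 0 1] = ((1 : NNReal) : ℝ) := variance_id_gaussianReal
  rw [this]; simp

lemma second_X {d : ℕ} (n : ℕ) (lam : ℝ) (hl : 0 < lam) (v u : Fin d → ℝ)
    (hu : ∑ j, u j ^ 2 = 1) (i : Fin n) :
    Integrable (fun x : Fin n → Fin d → ℝ => (∑ j, u j * x i j) ^ 2) (PP n lam v) ∧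
    ∫ x, (∑ j, u j * x i j) ^ 2 ∂(PP n lam v) = lam * (∑ j, u j * v j) ^ 2 + 1 := by
  set a : Fin n ⊕ Fin n × Fin d → ℝ := Sum.elim
    (fun i' => if i' = i then Real.sqrt lam * ∑ j, u j * v j else 0)
    (fun q => if q.1 = i then u q.2 else 0) with ha
  have hX : ∀ w : Fin n ⊕ Fin n × Fin d → ℝ,
      ∑ j, u j * Xmap lam v w i j = ∑ q, a q * w q := by
    intro w
    rw [Fintype.sum_sum_type, Fintype.sum_prod_type]
    simp only [ha, Sum.elim_inl, Sum.elim_inr, ite_mul, zero_mul]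
    rw [Finset.sum_ite_eq' , Finset.sum_comm]
    simp only [Finset.sum_ite_eq', Finset.mem_univ, if_true]
    rw [Finset.mul_sum, Finset.sum_mul, ← Finset.sum_add_distrib]
    refine Finset.sum_congr rfl fun j _ => ?_
    unfold Xmap
    ring
  have ha2 : ∑ q, a q ^ 2 = lam * (∑ j, u j * v j) ^ 2 + 1 := by
    rw [Fintype.sum_sum_type, Fintype.sum_prod_type]
    simp only [ha, Sum.elim_inl, Sum.elim_inr, ite_pow]
    rw [Finset.sum_comm (s := (Finset.univ : Finset (Fin n)))]
    simp [mul_pow, Real.sq_sqrt hl.le, hu]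
  have hm : Measurable (fun x : Fin n → Fin d → ℝ => (∑ j, u j * x i j) ^ 2) := by fun_prop
  obtain ⟨h1, h2⟩ := gam_second _ a
  unfold PP
  rw [integrable_map_measure hm.aestronglyMeasurable (measurable_Xmap lam v).aemeasurable,
    integral_map (measurable_Xmap lam v).aemeasurable hm.aestronglyMeasurable]
  simp only [Function.comp_def, hX]
  exact ⟨h1, h2.trans ha2⟩

lemma integral_llr {d : ℕ} (n : ℕ) (lam : ℝ) (hl : 0 < lam) (v u : Fin d → ℝ)
    (hv : ∑ j, v j ^ 2 = 1) (hu : ∑ j, u j ^ 2 = 1) :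
    Integrable (llr (n := n) lam v u) (PP n lam v) ∧
    ∫ x, llr lam v u x ∂(PP n lam v) =
      n * (lam ^ 2 / (1 + lam)) / 2 * (1 - (∑ j, u j * v j) ^ 2) := by
  have hvv : ∑ j, v j * v j = 1 := by rw [← hv]; simp [sq]
  have I1 := fun i => second_X n lam hl v v hv i
  have I2 := fun i => second_X n lam hl v u hu i
  have J1 : Integrable (fun x : Fin n → Fin d → ℝ => ∑ i, (∑ j, v j * x i j) ^ 2) (PP n lam v) :=
    integrable_finsetSum _ fun i _ => (I1 i).1
  have J2 : Integrable (fun x : Fin n → Fin d → ℝ => ∑ i, (∑ j, u j * x i j) ^ 2) (PP n lam v) :=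
    integrable_finsetSum _ fun i _ => (I2 i).1
  unfold llr
  refine ⟨(J1.sub J2).const_mul _, ?_⟩
  rw [integral_const_mul, integral_sub J1 J2, integral_finsetSum _ fun i _ => (I1 i).1,
    integral_finsetSum _ fun i _ => (I2 i).1]
  simp_rw [(I1 _).2, (I2 _).2, hvv]
  simp
  have : 1 + lam ≠ 0 := by positivity
  field_simp

lemma exp_neg_llr {d : ℕ} (n : ℕ) (lam : ℝ) (hl : 0 < lam) (v u : Fin d → ℝ)
    (hv : ∑ j, v j ^ 2 = 1) (hu : ∑ j, u j ^ 2 = 1) :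
    Integrable (fun x => Real.exp (-llr (n := n) lam v u x)) (PP n lam v) ∧
    ∫ x, Real.exp (-llr (n := n) lam v u x) ∂(PP n lam v) = 1 := by
  have hm := measurable_llr (n := n) lam v u
  have h : ∫⁻ x, ENNReal.ofReal (Real.exp (-llr (n := n) lam v u x)) ∂(PP n lam v) = 1 := by
    rw [PP_change n lam hl v u hv hu _ (by fun_prop)]
    simp_rw [← ENNReal.ofReal_mul (Real.exp_pos _).le, ← Real.exp_add]
    simp
  have hi : Integrable (fun x => Real.exp (-llr (n := n) lam v u x)) (PP n lam v) := by
    refine ⟨by fun_prop, ?_⟩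
    rw [hasFiniteIntegral_iff_ofReal (Filter.Eventually.of_forall fun x => (Real.exp_pos _).le), h]
    simp
  refine ⟨hi, ?_⟩
  rw [integral_eq_lintegral_of_nonneg_ae (Filter.Eventually.of_forall fun x => (Real.exp_pos _).le)
    hi.1, h]
  simp

lemma PP_event {d : ℕ} (n : ℕ) (lam : ℝ) (hl : 0 < lam) (v u : Fin d → ℝ)
    (hv : ∑ j, v j ^ 2 = 1) (hu : ∑ j, u j ^ 2 = 1) (t : ℝ) (ht : 0 < t)
    (A : Set (Fin n → Fin d → ℝ)) (hA : MeasurableSet A) :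
    (PP n lam v).real A ≤ Real.exp t * (PP n lam u).real A +
      (n * (lam ^ 2 / (1 + lam)) / 2 * (1 - (∑ j, u j * v j) ^ 2) + 1) / t := by
  have hm := measurable_llr (n := n) lam v u
  set B := {x : Fin n → Fin d → ℝ | t ≤ llr lam v u x} with hB
  have hBm : MeasurableSet B := measurableSet_le measurable_const hm
  have h1 : (PP n lam v).real B ≤
      (n * (lam ^ 2 / (1 + lam)) / 2 * (1 - (∑ j, u j * v j) ^ 2) + 1) / t := by
    obtain ⟨i1, e1⟩ := integral_llr n lam hl v u hv hu
    obtain ⟨i2, e2⟩ := exp_neg_llr n lam hl v u hv hu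
    have hmk := mul_meas_ge_le_integral_of_nonneg (μ := PP n lam v)
      (f := fun x => llr lam v u x + Real.exp (-llr lam v u x))
      (Filter.Eventually.of_forall fun x => by
        have := Real.add_one_le_exp (-llr lam v u x)
        simp only [Pi.zero_apply]; linarith) (i1.add i2) t
    rw [integral_add i1 i2, e1, e2] at hmk
    rw [le_div_iff₀ ht, mul_comm]
    refine le_trans (mul_le_mul_of_nonneg_left (measureReal_mono (fun x hx => ?_)) ht.le) hmk
    have := Real.exp_pos (-llr lam v u x)
    simp only [hB, Set.mem_ofPred_eq] at hx ⊢
    linarith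
  have h2 : (PP n lam v).real (A \ B) ≤ Real.exp t * (PP n lam u).real A := by
    have : PP n lam v (A \ B) ≤ ENNReal.ofReal (Real.exp t) * PP n lam u A := by
      have hAB := hA.diff hBm
      rw [← lintegral_indicator_one hAB, PP_change n lam hl v u hv hu _
        (measurable_one.indicator hAB), ← lintegral_indicator_one hA,
        ← lintegral_const_mul _ (measurable_one.indicator hA)]
      refine lintegral_mono fun x => ?_
      by_cases hx : x ∈ A \ B
      · have hx2 := hx.2
        simp only [hB, Set.mem_ofPred_eq, not_le] at hx2
        simp only [Set.indicator_of_mem hx, Set.indicator_of_mem hx.1, Pi.one_apply, one_mul,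
          mul_one]
        exact ENNReal.ofReal_le_ofReal (Real.exp_le_exp.2 hx2.le)
      · simp [Set.indicator_of_notMem hx]
    have := ENNReal.toReal_mono (by finiteness) this
    rwa [ENNReal.toReal_mul, ENNReal.toReal_ofReal (Real.exp_pos _).le] at this
  calc (PP n lam v).real A ≤ (PP n lam v).real ((A \ B) ∪ B) := measureReal_mono (by simp)
    _ ≤ (PP n lam v).real (A \ B) + (PP n lam v).real B := measureReal_union_le _ _
    _ ≤ _ := add_le_add h2 h1

lemma frob_eq_norm {d : ℕ} (A : Matrix (Fin d) (Fin d) ℝ) :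
    frob A = ‖(WithLp.toLp 2 (fun q : Fin d × Fin d => A q.1 q.2) :
      EuclideanSpace ℝ (Fin d × Fin d))‖ := by
  rw [EuclideanSpace.norm_eq, Fintype.sum_prod_type]
  simp [frob]

lemma frob_triangle {d : ℕ} (H A B : Matrix (Fin d) (Fin d) ℝ) :
    frob (A - B) ≤ frob (H - A) + frob (H - B) := by
  simp only [frob_eq_norm]
  have h : ∀ X Y : Matrix (Fin d) (Fin d) ℝ,
      (WithLp.toLp 2 (fun q : Fin d × Fin d => (X - Y) q.1 q.2) :
        EuclideanSpace ℝ (Fin d × Fin d)) =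
      WithLp.toLp 2 (fun q : Fin d × Fin d => X q.1 q.2) -
      WithLp.toLp 2 (fun q : Fin d × Fin d => Y q.1 q.2) := by
    intro X Y; rfl
  rw [h, h, h, norm_sub_rev (WithLp.toLp 2 (fun q : Fin d × Fin d => H q.1 q.2))]
  exact norm_sub_le_norm_sub_add_norm_sub _ _ _

lemma frob_unit {d : ℕ} (u v : Fin d → ℝ) (hv : ∑ j, v j ^ 2 = 1) (hu : ∑ j, u j ^ 2 = 1) :
    frob (vecMulVec u u - vecMulVec v v) = Real.sqrt (2 * (1 - (∑ j, u j * v j) ^ 2)) := by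
  unfold frob
  congr 1
  have h : ∀ a b : Fin d → ℝ, ∑ i, ∑ j, a i * b j = (∑ i, a i) * ∑ j, b j := by
    intro a b; rw [Finset.sum_mul_sum]
  calc ∑ i, ∑ j, (vecMulVec u u - vecMulVec v v) i j ^ 2
      = ∑ i, ∑ j, (u i ^ 2 * u j ^ 2 + v i ^ 2 * v j ^ 2 - 2 * ((u i * v i) * (u j * v j))) := by
        refine Finset.sum_congr rfl fun i _ => Finset.sum_congr rfl fun j _ => ?_
        simp only [Matrix.sub_apply, vecMulVec_apply]
        ring
    _ = _ := by
        simp_rw [Finset.sum_sub_distrib, Finset.sum_add_distrib, ← Finset.mul_sum,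
          ← Finset.sum_mul, hu, hv]
        ring

lemma measurable_frob {d n : ℕ} (vhat : (Fin n → Fin d → ℝ) → Fin d → ℝ) (hm : Measurable vhat)
    (v : Fin d → ℝ) :
    Measurable (fun x => frob (vecMulVec (vhat x) (vhat x) - vecMulVec v v)) := by
  unfold frob
  simp only [Matrix.sub_apply, vecMulVec_apply]
  fun_prop

lemma fano {d : ℕ} (n : ℕ) (lam : ℝ) (hl : 0 < lam) {J : Type} [Fintype J]
    (V : J → Fin d → ℝ) (u : Fin d → ℝ) (hV : ∀ c, ∑ j, V c j ^ 2 = 1) (hu : ∑ j, u j ^ 2 = 1)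
    (ε : ℝ) (hε : 0 < ε) (hc : ∀ c, 1 - (∑ j, u j * V c j) ^ 2 ≤ ε ^ 2)
    (hsep : ∀ c c', c ≠ c' → ε ≤ frob (vecMulVec (V c) (V c) - vecMulVec (V c') (V c')))
    (hM : 64 ≤ Fintype.card J)
    (hn : n * (lam ^ 2 / (1 + lam)) * ε ^ 2 ≤ Real.log (Fintype.card J) / 8)
    (vhat : (Fin n → Fin d → ℝ) → Fin d → ℝ) (hm : Measurable vhat) :
    ∃ c, ENNReal.ofReal (ε / 8) ≤ ∫⁻ x, ENNReal.ofReal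
      (frob (vecMulVec (vhat x) (vhat x) - vecMulVec (V c) (V c))) ∂(PP n lam (V c)) := by
  by_contra! hcon
  set M : ℝ := ((Fintype.card J : ℕ) : ℝ) with hMdef
  have hM64 : (64 : ℝ) ≤ M := by rw [hMdef]; exact_mod_cast hM
  have hlog : 41 / 10 ≤ Real.log M := by
    have h1 : Real.log 64 ≤ Real.log M := Real.log_le_log (by norm_num) hM64
    have h2 : Real.log 64 = 6 * Real.log 2 := by
      rw [show (64 : ℝ) = 2 ^ 6 by norm_num, Real.log_pow]; norm_num
    have := Real.log_two_gt_d9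
    linarith
  set A : J → Set (Fin n → Fin d → ℝ) := fun c =>
    {x | frob (vecMulVec (vhat x) (vhat x) - vecMulVec (V c) (V c)) < ε / 2} with hA
  have hAm : ∀ c, MeasurableSet (A c) := fun c =>
    measurableSet_lt (measurable_frob vhat hm (V c)) measurable_const
  have hdisj : Pairwise (Function.onFun Disjoint A) := by
    intro c c' hne
    rw [Function.onFun, Set.disjoint_left]
    intro x hx hx'
    simp only [hA, Set.mem_ofPred_eq] at hx hx'
    have := frob_triangle (vecMulVec (vhat x) (vhat x)) (vecMulVec (V c) (V c))
      (vecMulVec (V c') (V c'))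
    have := hsep c c' hne
    linarith
  have hbig : ∀ c, 3 / 4 ≤ (PP n lam (V c)).real (A c) := by
    intro c
    have hmk := mul_meas_ge_le_lintegral (μ := PP n lam (V c))
      (measurable_frob vhat hm (V c)).ennreal_ofReal (ENNReal.ofReal (ε / 2))
    have h1 := lt_of_le_of_lt hmk (hcon c)
    have h2 : PP n lam (V c) (A c)ᶜ ≤ PP n lam (V c) {x | ENNReal.ofReal (ε / 2) ≤
        ENNReal.ofReal (frob (vecMulVec (vhat x) (vhat x) - vecMulVec (V c) (V c)))} := by
      refine measure_mono fun x hx => ?_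
      simp only [hA, Set.mem_compl_iff, Set.mem_ofPred_eq, not_lt] at hx ⊢
      exact ENNReal.ofReal_le_ofReal hx
    have h3 : ENNReal.ofReal (ε / 2) * PP n lam (V c) (A c)ᶜ ≤ ENNReal.ofReal (ε / 8) :=
      (mul_le_mul_right h2 _).trans h1.le
    have h4 := ENNReal.toReal_mono (by finiteness) h3
    rw [ENNReal.toReal_mul, ENNReal.toReal_ofReal (by positivity),
      ENNReal.toReal_ofReal (by positivity)] at h4
    change ε / 2 * (PP n lam (V c)).real (A c)ᶜ ≤ ε / 8 at h4
    rw [probReal_compl_eq_one_sub (hAm c)] at h4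
    nlinarith
  have hQ : ∑ c, (PP n lam u).real (A c) ≤ 1 := by
    rw [← measureReal_iUnion_fintype hdisj hAm]
    exact measureReal_le_one
  have hexp : Real.exp (Real.log M / 2) = Real.sqrt M := by
    rw [Real.sqrt_eq_rpow, Real.rpow_def_of_pos (by linarith)]
    congr 1; ring
  have hup : ∀ c, (PP n lam (V c)).real (A c) ≤ Real.sqrt M * (PP n lam u).real (A c) + 62 / 100 := by
    intro c
    have h := PP_event n lam hl (V c) u (hV c) hu (Real.log M / 2) (by linarith) (A c) (hAm c)
    rw [hexp] at h
    refine h.trans (add_le_add le_rfl ?_)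
    rw [div_le_iff₀ (by linarith)]
    have : n * (lam ^ 2 / (1 + lam)) * (1 - (∑ j, u j * V c j) ^ 2) ≤
        n * (lam ^ 2 / (1 + lam)) * ε ^ 2 := mul_le_mul_of_nonneg_left (hc c) (by positivity)
    linarith
  have hs8 : 8 ≤ Real.sqrt M := Real.le_sqrt_of_sq_le (by linarith)
  have hss : Real.sqrt M * Real.sqrt M = M := Real.mul_self_sqrt (by linarith)
  have hsum : ∑ c : J, (3 / 4 : ℝ) ≤ ∑ c, (Real.sqrt M * (PP n lam u).real (A c) + 62 / 100) :=
    Finset.sum_le_sum fun c _ => (hbig c).trans (hup c)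
  rw [Finset.sum_add_distrib, ← Finset.mul_sum] at hsum
  simp only [Finset.sum_const, Finset.card_univ, nsmul_eq_mul, ← hMdef] at hsum
  have : Real.sqrt M * ∑ c, (PP n lam u).real (A c) ≤ Real.sqrt M :=
    mul_le_of_le_one_right (by positivity) hQ
  nlinarith

lemma code_agree {p m t : ℕ} [Fact p.Prime] (hmp : m ≤ p) (c c' : Fin t → ZMod p) (hne : c ≠ c') :
    (Finset.univ.filter fun i : Fin m =>
      ∑ s : Fin t, ((i : ℕ) : ZMod p) ^ (s : ℕ) * c s =
      ∑ s : Fin t, ((i : ℕ) : ZMod p) ^ (s : ℕ) * c' s).card < t := by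
  by_contra! h
  set S := (Finset.univ.filter fun i : Fin m =>
      ∑ s : Fin t, ((i : ℕ) : ZMod p) ^ (s : ℕ) * c s =
      ∑ s : Fin t, ((i : ℕ) : ZMod p) ^ (s : ℕ) * c' s) with hS
  obtain ⟨e⟩ : Nonempty (Fin t ↪ S) := Function.Embedding.nonempty_of_card_le (by simpa using h)
  apply hne
  have hz : (fun s => c s - c' s) = 0 := by
    refine Matrix.eq_zero_of_forall_index_sum_pow_mul_eq_zero
      (f := fun r : Fin t => (((e r : Fin m) : ℕ) : ZMod p)) ?_ ?_
    · intro r r' hr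
      simp only at hr
      rw [ZMod.natCast_eq_natCast_iff'] at hr
      rw [Nat.mod_eq_of_lt ((e r : Fin m).2.trans_le hmp),
        Nat.mod_eq_of_lt ((e r' : Fin m).2.trans_le hmp)] at hr
      exact e.injective (Subtype.ext (Fin.ext hr))
    · intro r
      have := (e r).2
      simp only [hS, Finset.mem_filter, Finset.mem_univ, true_and] at this
      simp only [mul_sub, Finset.sum_sub_distrib]
      rw [this, sub_self]
  funext s
  have := congrFun hz s
  simpa [sub_eq_zero] using this

lemma packing {d m p : ℕ} [NeZero p] (hm : 1 ≤ m) (hd : m * p + 1 ≤ d) {J : Type}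
    (cw : J → Fin m → ZMod p)
    (hcw : ∀ c c', c ≠ c' → 2 * (Finset.univ.filter fun i => cw c i = cw c' i).card ≤ m)
    (ε : ℝ) (hε : 0 < ε) (hε1 : ε ≤ 1) :
    ∃ (V : J → Fin d → ℝ) (u : Fin d → ℝ), (∀ c, ∑ j, V c j ^ 2 = 1) ∧ ∑ j, u j ^ 2 = 1 ∧
      (∀ c, (Finset.univ.filter fun i => V c i ≠ 0).card ≤ m + 1) ∧
      (∀ c, 1 - (∑ j, u j * V c j) ^ 2 ≤ ε ^ 2) ∧
      (∀ c c', c ≠ c' → ε ≤ frob (vecMulVec (V c) (V c) - vecMulVec (V c') (V c'))) := by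
  obtain ⟨e⟩ : Nonempty (Option (Fin m × ZMod p) ↪ Fin d) :=
    Function.Embedding.nonempty_of_card_le (by simpa [ZMod.card] using hd)
  set W : J → Option (Fin m × ZMod p) → ℝ := fun c o =>
    o.elim (Real.sqrt (1 - ε ^ 2)) (fun q => if q.2 = cw c q.1 then ε / Real.sqrt m else 0) with hW
  set U : Option (Fin m × ZMod p) → ℝ := fun o => o.elim 1 (fun _ => 0) with hU
  have hsum : ∀ f g : Option (Fin m × ZMod p) → ℝ,
      ∑ j, Function.extend e f 0 j * Function.extend e g 0 j = ∑ o, f o * g o := by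
    intro f g
    symm
    refine Fintype.sum_of_injective e e.injective _ _ ?_ ?_
    · intro j hj
      rw [Function.extend_apply' _ _ _ (by simpa using hj)]
      simp
    · intro o
      rw [e.injective.extend_apply, e.injective.extend_apply]
  have h1ε : 0 ≤ 1 - ε ^ 2 := by nlinarith
  have hm0 : (0 : ℝ) < m := by exact_mod_cast hm
  have hWW : ∀ c c', ∑ o, W c o * W c' o = (1 - ε ^ 2) +
      ε ^ 2 / m * (Finset.univ.filter fun i => cw c i = cw c' i).card := by
    intro c c'
    rw [Fintype.sum_option, Fintype.sum_prod_type]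
    simp only [hW, Option.elim]
    rw [Real.mul_self_sqrt h1ε]
    congr 1
    simp only [ite_mul, zero_mul, Finset.sum_ite_eq', Finset.sum_ite_eq, Finset.mem_univ, if_true]
    rw [Finset.card_filter]
    push_cast
    rw [Finset.mul_sum]
    refine Finset.sum_congr rfl fun i _ => ?_
    split_ifs
    · rw [div_mul_div_comm, Real.mul_self_sqrt hm0.le]; ring
    · simp
  have hV : ∀ c, ∑ j, Function.extend e (W c) 0 j ^ 2 = 1 := by
    intro c
    simp only [sq]
    rw [hsum, hWW]
    simp
    field_simp
    ring
  refine ⟨fun c => Function.extend e (W c) 0, Function.extend e U 0, hV, ?_, ?_, ?_, ?_⟩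
  · simp only [sq]
    rw [hsum, Fintype.sum_option]
    simp [hU]
  · intro c
    have : (Finset.univ.filter fun i => Function.extend e (W c) 0 i ≠ 0) ⊆
        (Finset.univ : Finset (Option (Fin m))).image
          (fun o => e (o.map (fun i => (i, cw c i)))) := by
      intro j hj
      simp only [Finset.mem_filter, Finset.mem_univ, true_and] at hj
      by_cases hr : ∃ o, e o = j
      · obtain ⟨o, rfl⟩ := hr
        rw [e.injective.extend_apply] at hj
        simp only [Finset.mem_image, Finset.mem_univ, true_and]
        rcases o with _ | ⟨i, a⟩
        · exact ⟨none, rfl⟩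
        · refine ⟨some i, ?_⟩
          simp only [hW, Option.elim, ne_eq, ite_eq_right_iff, not_forall] at hj
          obtain ⟨ha, -⟩ := hj
          simp [ha]
      · rw [Function.extend_apply' _ _ _ hr] at hj
        simp at hj
    refine (Finset.card_le_card this).trans (Finset.card_image_le.trans ?_)
    simp
  · intro c
    rw [hsum, Fintype.sum_option]
    simp [hU, hW, Real.sq_sqrt h1ε]
  · intro c c' hne
    rw [frob_unit _ _ (hV c') (hV c), hsum, hWW]
    have hag := hcw c c' hne
    set a := (Finset.univ.filter fun i => cw c i = cw c' i).card
    have hag' : (2 : ℝ) * a ≤ m := by exact_mod_cast hag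
    have ha0 : (0 : ℝ) ≤ a := by positivity
    refine Real.le_sqrt_of_sq_le ?_
    set x := ε ^ 2 / m * (a : ℝ) with hx
    have hx0 : 0 ≤ x := by positivity
    have hx1 : x ≤ ε ^ 2 / 2 := by
      rw [hx, div_mul_eq_mul_div, div_le_div_iff₀ hm0 (by norm_num)]
      nlinarith [sq_nonneg ε]
    nlinarith

lemma numerics (d k : ℕ) (hk : 2 ≤ k) (hkd : k ≤ d)
    (h : 16 * (d : ℝ) ≤ ((d : ℝ) / (k : ℝ) ^ 3) ^ ((k : ℝ) / 2)) :
    3 ≤ k ∧ k ^ 3 ≤ d ∧ (k = 3 → 1000 ≤ d) := by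
  have hd2 : (2 : ℝ) ≤ d := by exact_mod_cast hk.trans hkd
  have hk0 : (0 : ℝ) < k := by positivity
  have hy0 : 0 ≤ (d : ℝ) / (k : ℝ) ^ 3 := by positivity
  refine ⟨?_, ?_, ?_⟩
  · by_contra! hlt
    have hk2 : k = 2 := by omega
    subst hk2
    norm_num at h
    linarith
  · by_contra! hlt
    have hlt' : (d : ℝ) < (k : ℝ) ^ 3 := by exact_mod_cast hlt
    have h1 : (d : ℝ) / (k : ℝ) ^ 3 ≤ 1 := by
      rw [div_le_one (by positivity)]; exact hlt'.le
    have := Real.rpow_le_one hy0 h1 (z := (k : ℝ) / 2) (by positivity)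
    linarith
  · intro hk3
    subst hk3
    by_contra! hlt
    have hlt' : (d : ℝ) < 1000 := by exact_mod_cast hlt
    have hy : (0 : ℝ) < (d : ℝ) / ((3 : ℕ) : ℝ) ^ 3 := by positivity
    rw [show (((3 : ℕ) : ℝ) / 2) = 1 + 1 / 2 by norm_num, Real.rpow_add hy, Real.rpow_one,
      ← Real.sqrt_eq_rpow] at h
    have hs : Real.sqrt ((d : ℝ) / ((3 : ℕ) : ℝ) ^ 3) ≤ 7 := by
      rw [Real.sqrt_le_left (by norm_num)]
      norm_num
      linarith
    have h2 : (d : ℝ) / ((3 : ℕ) : ℝ) ^ 3 * Real.sqrt ((d : ℝ) / ((3 : ℕ) : ℝ) ^ 3) ≤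
      (d : ℝ) / ((3 : ℕ) : ℝ) ^ 3 * 7 := mul_le_mul_of_nonneg_left hs hy.le
    norm_num at h h2
    linarith

lemma exists_prime_size (d k : ℕ) (hk : 3 ≤ k) (hkd : k ^ 3 ≤ d) (h3 : k = 3 → 1000 ≤ d) :
    ∃ p : ℕ, p.Prime ∧ k - 1 ≤ p ∧ (k - 1) * p + 1 ≤ d ∧ d ≤ p ^ 3 ∧ 64 ≤ p ^ (k / 2) := by
  obtain ⟨m, rfl⟩ : ∃ m, k = m + 1 := ⟨k - 1, by omega⟩
  have hm : 2 ≤ m := by omega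
  simp only [Nat.add_sub_cancel]
  have hd27 : 27 ≤ d := le_trans (by
    calc 27 = 3 ^ 3 := by norm_num
      _ ≤ (m + 1) ^ 3 := Nat.pow_le_pow_left hk 3) hkd
  have h2m : 2 * m ≤ d - 1 := by
    have : 2 * m + 1 ≤ (m + 1) ^ 3 := by nlinarith [sq_nonneg m]
    omega
  have hN : (d - 1) / (2 * m) ≠ 0 := (Nat.div_pos h2m (by omega)).ne'
  obtain ⟨p, hp, hlt, hle⟩ := Nat.exists_prime_lt_and_le_two_mul _ hN
  have hup : m * p + 1 ≤ d := by
    have h1 : m * p ≤ m * (2 * ((d - 1) / (2 * m))) := Nat.mul_le_mul_left m hle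
    have h2 : 2 * m * ((d - 1) / (2 * m)) ≤ d - 1 := Nat.mul_div_le _ _
    have h4 : m * (2 * ((d - 1) / (2 * m))) = 2 * m * ((d - 1) / (2 * m)) := by ring
    omega
  have hlow : d ≤ 2 * m * p := by
    rw [Nat.div_lt_iff_lt_mul (by omega)] at hlt
    have : p * (2 * m) = 2 * m * p := by ring
    omega
  have hp3 : (m + 1) ^ 2 ≤ 2 * p := by
    by_contra! hc
    have h1 : m * (2 * p) ≤ m * (m + 1) ^ 2 := Nat.mul_le_mul_left m hc.le
    nlinarith [sq_nonneg m]
  refine ⟨p, hp, ?_, hup, ?_, ?_⟩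
  · nlinarith
  · have h1 : d ^ 3 ≤ (2 * m * p) ^ 3 := Nat.pow_le_pow_left hlow 3
    have h2 : (2 * m * p) ^ 3 = 8 * m ^ 3 * p ^ 3 := by ring
    have h4 : m ^ 3 ≤ d := (Nat.pow_le_pow_left (Nat.le_succ m) 3).trans hkd
    have h5 : 8 * m ^ 3 * p ^ 3 ≤ 8 * d * p ^ 3 := by gcongr
    have h6 : d * d ^ 2 ≤ d * (8 * p ^ 3) := by nlinarith
    have h7 : d ^ 2 ≤ 8 * p ^ 3 := Nat.le_of_mul_le_mul_left h6 (by omega)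
    nlinarith
  · rcases Nat.eq_or_lt_of_le hm with h | h
    · subst h
      have := h3 rfl
      norm_num
      omega
    · have h8 : 8 ≤ p := by nlinarith
      calc 64 = 8 ^ 2 := by norm_num
        _ ≤ p ^ 2 := Nat.pow_le_pow_left h8 2
        _ ≤ p ^ ((m + 1) / 2) := Nat.pow_le_pow_right (by omega) (by omega)

/-- minimax lower bound for vanilla sparse PCA, Eq. (7). -/
theorem minimax_lower_bound_sparse_pca :
    ∃ c : ℝ, 0 < c ∧
      ∀ (d k n : ℕ), 2 ≤ k → k ≤ d → 1 ≤ n →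
        16 * (d : ℝ) ≤ ((d : ℝ) / (k : ℝ) ^ 3) ^ ((k : ℝ) / 2) →
        ∀ lam : ℝ, 0 < lam →
        ∀ vhat : (Fin n → Fin d → ℝ) → Fin d → ℝ, Measurable vhat →
        ∃ vstar : Fin d → ℝ, nrm vstar = 1 ∧
          (Finset.univ.filter fun i => vstar i ≠ 0).card ≤ k ∧
          ∀ (Ω : Type) (_ : MeasurableSpace Ω) (μ : Measure Ω), IsProbabilityMeasure μ →
            ∀ x : Fin n → Ω → Fin d → ℝ, IsSpikedWishart μ lam vstar x →
              ENNReal.ofReal (c *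
                min 1 (Real.sqrt ((1 + lam) / (8 * lam ^ 2)) *
                  Real.sqrt ((k * Real.log d) / n)))
              ≤ ∫⁻ ω, ENNReal.ofReal
                  (frob (vecMulVec (vhat fun i => x i ω) (vhat fun i => x i ω) -
                    vecMulVec vstar vstar)) ∂μ := by
  refine ⟨1 / 32, by norm_num, ?_⟩
  intro d k n hk hkd hn hcond lam hl vhat hvm
  obtain ⟨hk3, hkd3, h1000⟩ := numerics d k hk hkd hcond
  obtain ⟨p, hp, hmp, hpd, hdp, hM⟩ := exists_prime_size d k hk3 hkd3 h1000
  haveI : Fact p.Prime := ⟨hp⟩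
  haveI : NeZero p := ⟨hp.ne_zero⟩
  have hd2 : (2 : ℝ) ≤ d := by exact_mod_cast hk.trans hkd
  have hlogd : 0 < Real.log d := Real.log_pos (by linarith)
  have hn0 : (0 : ℝ) < n := by exact_mod_cast hn
  have hk0 : (3 : ℝ) ≤ k := by exact_mod_cast hk3
  set R := Real.sqrt ((1 + lam) / (8 * lam ^ 2)) * Real.sqrt ((k * Real.log d) / n) with hR
  have hR0 : 0 < R := by
    rw [hR]
    have h1 : 0 < (1 + lam) / (8 * lam ^ 2) := by positivity
    have h2 : 0 < (k * Real.log d) / n := by positivity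
    exact mul_pos (Real.sqrt_pos.2 h1) (Real.sqrt_pos.2 h2)
  have hRsq : R ^ 2 = (1 + lam) / (8 * lam ^ 2) * ((k * Real.log d) / n) := by
    rw [hR, mul_pow, Real.sq_sqrt (by positivity), Real.sq_sqrt (by positivity)]
  set ε := min 1 R / 4 with hε
  have hmin : 0 < min 1 R := lt_min one_pos hR0
  have hε0 : 0 < ε := by positivity
  have hε1 : ε ≤ 1 := by have := min_le_left 1 R; linarith
  have hεR : ε ≤ R / 4 := by have := min_le_right 1 R; linarith
  set cw : (Fin (k / 2) → ZMod p) → Fin (k - 1) → ZMod p := fun c i =>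
    ∑ s : Fin (k / 2), ((i : ℕ) : ZMod p) ^ (s : ℕ) * c s with hcw
  obtain ⟨V, u, hV, hu, hsupp, hc, hsep⟩ := packing (d := d) (m := k - 1) (p := p) (by omega) hpd cw
    (fun c c' hne => by
      have := code_agree (m := k - 1) hmp c c' hne
      simp only [hcw]
      omega) ε hε0 hε1
  have hcard : Fintype.card (Fin (k / 2) → ZMod p) = p ^ (k / 2) := by
    simp [ZMod.card]
  have hlogM : k * Real.log d / 9 ≤ Real.log (p ^ (k / 2) : ℕ) := by
    push_cast
    rw [Real.log_pow]
    have h1 : Real.log d ≤ 3 * Real.log p := by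
      have : Real.log d ≤ Real.log ((p : ℝ) ^ 3) :=
        Real.log_le_log (by linarith) (by exact_mod_cast hdp)
      rw [Real.log_pow] at this
      exact_mod_cast this
    have h2 : (k : ℝ) ≤ 3 * ((k / 2 : ℕ) : ℝ) := by
      have : k ≤ 3 * (k / 2) := by omega
      exact_mod_cast this
    have : (k : ℝ) * Real.log d ≤ (3 * ((k / 2 : ℕ) : ℝ)) * (3 * Real.log p) :=
      mul_le_mul h2 h1 hlogd.le (by positivity)
    linarith
  obtain ⟨c, hfin⟩ := fano n lam hl V u hV hu ε hε0 hc hsep (by rw [hcard]; exact hM) (by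
    rw [hcard]
    have h1 : ε ^ 2 ≤ (R / 4) ^ 2 := pow_le_pow_left₀ hε0.le hεR 2
    have h2 : n * (lam ^ 2 / (1 + lam)) * ε ^ 2 ≤ n * (lam ^ 2 / (1 + lam)) * (R / 4) ^ 2 :=
      mul_le_mul_of_nonneg_left h1 (by positivity)
    have h3 : n * (lam ^ 2 / (1 + lam)) * (R / 4) ^ 2 = k * Real.log d / 128 := by
      rw [div_pow, hRsq]
      field_simp
      norm_num
    have : 0 < k * Real.log d := by positivity
    linarith) vhat hvm
  refine ⟨V c, ?_, ?_, ?_⟩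
  · unfold nrm; rw [hV c, Real.sqrt_one]
  · have := hsupp c
    omega
  · intro Ω _ μ hμ x hx
    obtain ⟨hxm, hmap⟩ := map_of_isSpiked μ lam (V c) x hx
    rw [← hmap, lintegral_map (measurable_frob vhat hvm (V c)).ennreal_ofReal hxm] at hfin
    refine le_trans (ENNReal.ofReal_le_ofReal ?_) hfin
    rw [hε]
    linarith

end StructuredPCA
end
end
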